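/- For every real u > 1: 2·𝒥(u) = 𝒫(u, 1/u) − 𝒫((u+1)/2, (u+1)/(2u)) − 𝒫(2u/(u+1), 2/(u+1)) + π²/6 + log(2)·log(u). -/

import Mathlib

open Real

/-- The digamma function ψ = Γ′/Γ. -/
noncomputable def digamma (x : ℝ) : ℝ := deriv Real.Gamma x / Real.Gamma x

/-- The Herglotz function F(x) = ∑_{n≥1} (ψ(nx) − log(nx))/n. -/
noncomputable def herglotzF (x : ℝ) : ℝ :=
  ∑' n : ℕ, (digamma (((n : ℝ) + 1) * x) - Real.log (((n : ℝ) + 1) * x)) / ((n : ℝ) + 1)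

/-- The modified Herglotz function 𝓕(x) = F(x) − F(1) + (π²/12)(x − 2 + 1/x) − (log x)²/4. -/
noncomputable def mathcalF (x : ℝ) : ℝ :=
  herglotzF x - herglotzF 1 + Real.pi ^ 2 / 12 * (x - 2 + 1 / x) - Real.log x ^ 2 / 4

/-- The dilogarithm Li₂(x) = ∑_{n≥1} xⁿ/n². -/
noncomputable def Li2 (x : ℝ) : ℝ := ∑' n : ℕ, x ^ (n + 1) / ((n : ℝ) + 1) ^ 2

open Classical in
/-- The Rogers dilogarithm, extended to all of ℝ. -/
noncomputable def rogersL (x : ℝ) : ℝ :=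
  if x < 0 then -(Li2 (x / (x - 1)) + Real.log (x / (x - 1)) * Real.log (1 - x / (x - 1)) / 2)
  else if x ≤ 1 then Li2 x + Real.log x * Real.log (1 - x) / 2
  else Real.pi ^ 2 / 3 - (Li2 (1 / x) + Real.log (1 / x) * Real.log (1 - 1 / x) / 2)

/-- J(x) = ∫₀¹ log(1+tˣ)/(1+t) dt. -/
noncomputable def Jfun (x : ℝ) : ℝ := ∫ t in (0:ℝ)..1, Real.log (1 + t ^ x) / (1 + t)

/-- 𝒥(x) = J(x) − (log 2)²/2 + (π²/24)(x − 1/x). -/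
noncomputable def mathcalJ (x : ℝ) : ℝ :=
  Jfun x - Real.log 2 ^ 2 / 2 + Real.pi ^ 2 / 24 * (x - 1 / x)

/-- 𝒫(x,y) = 𝓕(x) − 𝓕(y) + L(y/x). -/
noncomputable def mathcalP (x y : ℝ) : ℝ := mathcalF x - mathcalF y + rogersL (y / x)

theorem hasDerivAt_log_Gamma {x : ℝ} (hx : 0 < x) :
    HasDerivAt (Real.log ∘ Real.Gamma) (digamma x) x := by
  have hd : DifferentiableAt ℝ Real.Gamma x :=
    Real.differentiableAt_Gamma fun m h => by
      have : (0 : ℝ) ≤ m := m.cast_nonneg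
      linarith
  exact hd.hasDerivAt.log (Real.Gamma_pos_of_pos hx).ne'

theorem log_Gamma_add_one {x : ℝ} (hx : 0 < x) :
    (Real.log ∘ Real.Gamma) (x + 1) = Real.log x + (Real.log ∘ Real.Gamma) x := by
  simp only [Function.comp_apply]
  rw [Real.Gamma_add_one hx.ne', Real.log_mul hx.ne' (Real.Gamma_pos_of_pos hx).ne']

theorem digamma_add_one {x : ℝ} (hx : 0 < x) : digamma (x + 1) = digamma x + 1 / x := by
  have h1 : HasDerivAt (fun y => (Real.log ∘ Real.Gamma) (y + 1)) (digamma (x + 1)) x := by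
    have := hasDerivAt_log_Gamma (show 0 < x + 1 by linarith)
    exact this.comp_add_const x 1
  have h2 : HasDerivAt (fun y => Real.log y + (Real.log ∘ Real.Gamma) y)
      (x⁻¹ + digamma x) x :=
    (Real.hasDerivAt_log hx.ne').add (hasDerivAt_log_Gamma hx)
  have h3 : (fun y => (Real.log ∘ Real.Gamma) (y + 1)) =ᶠ[nhds x]
      fun y => Real.log y + (Real.log ∘ Real.Gamma) y := by
    filter_upwards [lt_mem_nhds hx] with y hy using log_Gamma_add_one hy
  rw [h1.unique (h2.congr_of_eventuallyEq h3)]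
  ring

theorem digamma_le_log {x : ℝ} (hx : 0 < x) : digamma x ≤ Real.log x := by
  have h := Real.convexOn_log_Gamma.le_slope_of_hasDerivAt (Set.mem_Ioi.2 hx)
    (Set.mem_Ioi.2 (by linarith : 0 < x + 1)) (by linarith) (hasDerivAt_log_Gamma hx)
  rw [slope_def_field, log_Gamma_add_one hx] at h
  simpa using h

theorem log_sub_le_digamma {x : ℝ} (hx : 0 < x) : Real.log x - 1 / x ≤ digamma x := by
  have hx1 : 0 < x + 1 := by linarith
  have h := Real.convexOn_log_Gamma.slope_le_of_hasDerivAt (Set.mem_Ioi.2 hx)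
    (Set.mem_Ioi.2 hx1) (by linarith) (hasDerivAt_log_Gamma hx1)
  rw [slope_def_field, log_Gamma_add_one hx, digamma_add_one hx] at h
  have : Real.log x ≤ digamma x + 1 / x := by simpa using h
  linarith

/-- The defect `1/y - log (1 + 1/y)`. -/
noncomputable def logDefect (y : ℝ) : ℝ := 1 / y - (Real.log (y + 1) - Real.log y)

theorem logDefect_nonneg {y : ℝ} (hy : 0 < y) : 0 ≤ logDefect y := by
  have h := Real.log_le_sub_one_of_pos (show 0 < (y + 1) / y by positivity)
  rw [Real.log_div (by positivity) hy.ne'] at h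
  have : (y + 1) / y - 1 = 1 / y := by field_simp; ring
  unfold logDefect
  linarith

theorem logDefect_le {y : ℝ} (hy : 0 < y) : logDefect y ≤ 1 / y - 1 / (y + 1) := by
  have h := Real.log_le_sub_one_of_pos (show 0 < y / (y + 1) by positivity)
  rw [Real.log_div hy.ne' (by positivity)] at h
  have : y / (y + 1) - 1 = -(1 / (y + 1)) := by field_simp; ring
  unfold logDefect
  linarith

theorem hasDerivAt_logDefect {y : ℝ} (hy : 0 < y) :
    HasDerivAt logDefect (-(1 / (y ^ 2 * (y + 1)))) y := by
  have h1 : HasDerivAt (fun y : ℝ => 1 / y) (-(1 / y ^ 2)) y := by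
    simpa [one_div] using hasDerivAt_inv hy.ne'
  have h2 : HasDerivAt (fun y : ℝ => Real.log (y + 1)) (y + 1)⁻¹ y :=
    (Real.hasDerivAt_log (by positivity)).comp_add_const y 1
  convert! h1.sub (h2.sub (Real.hasDerivAt_log hy.ne')) using 1
  field_simp
  ring

/-- The telescoping series `∑ (1/(x+k) - 1/(x+k+1)) = 1/x`. -/
theorem hasSum_inv_sub_inv {x : ℝ} (hx : 0 < x) :
    HasSum (fun k : ℕ => 1 / (x + k) - 1 / (x + k + 1)) (1 / x) := by
  have hpos : ∀ k : ℕ, 0 < x + k := fun k => by positivity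
  rw [hasSum_iff_tendsto_nat_of_nonneg]
  · have h : ∀ n : ℕ, ∑ k ∈ Finset.range n, (1 / (x + k) - 1 / (x + k + 1))
        = 1 / x - 1 / (x + n) := by
      intro n
      have := Finset.sum_range_sub' (fun k : ℕ => 1 / (x + k)) n
      simp only [Nat.cast_zero, add_zero] at this
      rw [← this]
      refine Finset.sum_congr rfl fun k _ => ?_
      push_cast
      rw [add_assoc]
    simp_rw [h]
    have : Filter.Tendsto (fun n : ℕ => 1 / (x + n)) Filter.atTop (nhds 0) := by
      simp_rw [one_div]
      exact (Filter.tendsto_atTop_add_const_left _ x tendsto_natCast_atTop_atTop).inv_tendsto_atTop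
    simpa using this.const_sub (1 / x)
  · intro k
    have := hpos k
    rw [sub_nonneg]
    exact one_div_le_one_div_of_le this (by linarith)

theorem hasSum_logDefect {x : ℝ} (hx : 0 < x) :
    HasSum (fun k : ℕ => logDefect (x + k)) (Real.log x - digamma x) := by
  have hpos : ∀ k : ℕ, 0 < x + k := fun k => by positivity
  rw [hasSum_iff_tendsto_nat_of_nonneg fun k => logDefect_nonneg (hpos k)]
  have h : ∀ n : ℕ, ∑ k ∈ Finset.range n, logDefect (x + k)
      = (Real.log x - digamma x) - (Real.log (x + n) - digamma (x + n)) := by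
    intro n
    have := Finset.sum_range_sub' (fun k : ℕ => Real.log (x + k) - digamma (x + k)) n
    simp only [Nat.cast_zero, add_zero] at this
    rw [← this]
    refine Finset.sum_congr rfl fun k _ => ?_
    push_cast
    rw [← add_assoc, digamma_add_one (hpos k), logDefect]
    ring
  simp_rw [h]
  have h0 : Filter.Tendsto (fun n : ℕ => 1 / (x + n)) Filter.atTop (nhds 0) := by
    simp_rw [one_div]
    exact (Filter.tendsto_atTop_add_const_left _ x tendsto_natCast_atTop_atTop).inv_tendsto_atTop
  have h1 : Filter.Tendsto (fun n : ℕ => Real.log (x + n) - digamma (x + n))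
      Filter.atTop (nhds 0) := by
    refine squeeze_zero (fun n => ?_) (fun n => ?_) h0
    · linarith [digamma_le_log (hpos n)]
    · linarith [log_sub_le_digamma (hpos n)]
  simpa using h1.const_sub (Real.log x - digamma x)

/-- The common majorant of the double series for the Herglotz function and its derivative. -/
theorem summable_herglotz_majorant {x : ℝ} (hx : 0 < x) :
    Summable fun p : ℕ × ℕ => (1 / (((p.1 : ℝ) + 1) * x + p.2)
      - 1 / (((p.1 : ℝ) + 1) * x + p.2 + 1)) / ((p.1 : ℝ) + 1) := by
  have hs : ∀ n : ℕ, HasSum (fun k : ℕ => (1 / (((n : ℝ) + 1) * x + k)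
      - 1 / (((n : ℝ) + 1) * x + k + 1)) / ((n : ℝ) + 1))
      (1 / (((n : ℝ) + 1) * x) / ((n : ℝ) + 1)) := fun n =>
    (hasSum_inv_sub_inv (by positivity)).div_const _
  rw [summable_prod_of_nonneg]
  · refine ⟨fun n => (hs n).summable, ?_⟩
    simp_rw [fun n => (hs n).tsum_eq]
    have h := ((summable_nat_add_iff 1).2 (Real.summable_one_div_nat_pow.2 one_lt_two)).mul_left
      (1 / x)
    refine h.congr fun n => ?_
    push_cast
    field_simp
  · intro p
    have h : 0 < ((p.1 : ℝ) + 1) * x + p.2 := by positivity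
    refine div_nonneg (sub_nonneg.2 (one_div_le_one_div_of_le h (by linarith))) (by positivity)

theorem summable_logDefect {x : ℝ} (hx : 0 < x) :
    Summable fun p : ℕ × ℕ => logDefect (((p.1 : ℝ) + 1) * x + p.2) / ((p.1 : ℝ) + 1) := by
  refine (summable_herglotz_majorant hx).of_nonneg_of_le (fun p => ?_) fun p => ?_
  · exact div_nonneg (logDefect_nonneg (by positivity)) (by positivity)
  · gcongr
    exact logDefect_le (by positivity)

theorem herglotzF_eq {x : ℝ} (hx : 0 < x) :
    herglotzF x
      = -∑' p : ℕ × ℕ, logDefect (((p.1 : ℝ) + 1) * x + p.2) / ((p.1 : ℝ) + 1) := by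
  have hs : ∀ n : ℕ, HasSum (fun k : ℕ => logDefect (((n : ℝ) + 1) * x + k) / ((n : ℝ) + 1))
      ((Real.log (((n : ℝ) + 1) * x) - digamma (((n : ℝ) + 1) * x)) / ((n : ℝ) + 1)) := fun n =>
    (hasSum_logDefect (x := ((n : ℝ) + 1) * x) (by positivity)).div_const _
  have h := (summable_logDefect hx).hasSum.prod_fiberwise hs
  rw [← h.tsum_eq, herglotzF, ← tsum_neg]
  congr 1
  ext n
  ring

/-- The derivative of the Herglotz function, as a double series. -/
noncomputable def herglotzDeriv (x : ℝ) : ℝ :=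
  ∑' p : ℕ × ℕ, 1 / ((((p.1 : ℝ) + 1) * x + p.2) ^ 2 * (((p.1 : ℝ) + 1) * x + p.2 + 1))

theorem herglotzDeriv_term_le {x a : ℝ} (ha : 0 < a) (hax : a ≤ x) (p : ℕ × ℕ) :
    1 / ((((p.1 : ℝ) + 1) * x + p.2) ^ 2 * (((p.1 : ℝ) + 1) * x + p.2 + 1))
      ≤ 1 / a * ((1 / (((p.1 : ℝ) + 1) * a + p.2)
      - 1 / (((p.1 : ℝ) + 1) * a + p.2 + 1)) / ((p.1 : ℝ) + 1)) := by
  set n : ℝ := (p.1 : ℝ) + 1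
  set k : ℝ := (p.2 : ℝ)
  have hn : 0 < n := by positivity
  have hk : 0 ≤ k := by positivity
  have h : 1 / a * ((1 / (n * a + k) - 1 / (n * a + k + 1)) / n)
      = 1 / ((n * a) * (n * a + k) * (n * a + k + 1)) := by
    have : 0 < n * a + k := by positivity
    field_simp
    ring
  rw [h]
  have h1 : n * a ≤ n * x := by gcongr
  have : 0 < n * a := by positivity
  refine one_div_le_one_div_of_le (by positivity) ?_
  have hx : 0 < x := ha.trans_le hax
  have h2 : n * a ≤ n * x + k := by linarith
  rw [pow_two]
  refine mul_le_mul (mul_le_mul h2 (by linarith) ?_ ?_) (by linarith) ?_ ?_ <;> positivity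

theorem summable_herglotzDeriv {x : ℝ} (hx : 0 < x) :
    Summable fun p : ℕ × ℕ =>
      1 / ((((p.1 : ℝ) + 1) * x + p.2) ^ 2 * (((p.1 : ℝ) + 1) * x + p.2 + 1)) :=
  ((summable_herglotz_majorant hx).mul_left (1 / x)).of_nonneg_of_le (fun p => by positivity)
    (herglotzDeriv_term_le hx le_rfl)

theorem hasDerivAt_herglotzF {x : ℝ} (hx : 0 < x) :
    HasDerivAt herglotzF (herglotzDeriv x) x := by
  have ha : 0 < x / 2 := by positivity
  have hmem : x ∈ Set.Ioi (x / 2) := by simp only [Set.mem_Ioi]; linarith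
  have h := hasDerivAt_tsum_of_isPreconnected (𝕜 := ℝ)
    (g := fun (p : ℕ × ℕ) y => -(logDefect (((p.1 : ℝ) + 1) * y + p.2) / ((p.1 : ℝ) + 1)))
    (g' := fun (p : ℕ × ℕ) y =>
      1 / ((((p.1 : ℝ) + 1) * y + p.2) ^ 2 * (((p.1 : ℝ) + 1) * y + p.2 + 1)))
    ((summable_herglotz_majorant ha).mul_left (1 / (x / 2))) isOpen_Ioi
    (convex_Ioi (x / 2)).isPreconnected (fun p y hy => ?_) (fun p y hy => ?_) hmem
    (summable_logDefect hx).neg hmem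
  · refine h.congr_of_eventuallyEq ?_
    filter_upwards [lt_mem_nhds hx] with y hy
    rw [herglotzF_eq hy, tsum_neg]
  · have hy0 : 0 < y := ha.trans hy
    have hpos : 0 < ((p.1 : ℝ) + 1) * y + p.2 := by positivity
    have h1 : HasDerivAt (fun y => ((p.1 : ℝ) + 1) * y + p.2) ((p.1 : ℝ) + 1) y := by
      simpa using ((hasDerivAt_id y).const_mul ((p.1 : ℝ) + 1)).add_const (p.2 : ℝ)
    convert! (((hasDerivAt_logDefect hpos).comp y h1).div_const ((p.1 : ℝ) + 1)).neg using 1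
    field_simp
  · have hy0 : 0 < y := ha.trans hy
    rw [Real.norm_of_nonneg (by positivity)]
    exact herglotzDeriv_term_le ha (le_of_lt hy) p

open MeasureTheory in
/-- Termwise integration over `(0, ∞)` of a series of nonnegative functions with nonzero total
integral. -/
theorem integrableOn_and_integral_eq_of_hasSum {ι : Type*} [Countable ι] {f : ι → ℝ → ℝ}
    {g : ℝ → ℝ} {c : ι → ℝ} {S : ℝ} (hf0 : ∀ i, ∀ t ∈ Set.Ioi (0 : ℝ), 0 ≤ f i t)
    (hfi : ∀ i, IntegrableOn (f i) (Set.Ioi 0)) (hfc : ∀ i, ∫ t in Set.Ioi 0, f i t = c i)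
    (hc : HasSum c S) (hS : S ≠ 0) (hg : ∀ t ∈ Set.Ioi (0 : ℝ), ∑' i, f i t = g t) :
    IntegrableOn g (Set.Ioi 0) ∧ ∫ t in Set.Ioi 0, g t = S := by
  have hnorm : ∀ i, ∫ t in Set.Ioi 0, ‖f i t‖ = c i := fun i => by
    rw [← hfc i]
    exact setIntegral_congr_fun measurableSet_Ioi fun t ht => Real.norm_of_nonneg (hf0 i t ht)
  have h := hasSum_integral_of_summable_integral_norm (μ := volume.restrict (Set.Ioi 0)) hfi
    (by simpa only [hnorm] using hc.summable)
  simp only [hfc] at h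
  have hgi : ∫ t in Set.Ioi 0, g t = S := by
    rw [← setIntegral_congr_fun measurableSet_Ioi hg]
    exact h.unique hc
  exact ⟨by_contra fun hn => hS (hgi ▸ integral_undef hn), hgi⟩

open MeasureTheory in
theorem integral_mul_exp_neg_mul_Ioi {y : ℝ} (hy : 0 < y) :
    IntegrableOn (fun t => t * Real.exp (-(y * t))) (Set.Ioi 0) ∧
      ∫ t in Set.Ioi 0, t * Real.exp (-(y * t)) = 1 / y ^ 2 := by
  have h := Real.integral_rpow_mul_exp_neg_mul_Ioi two_pos hy
  have h1 : ((2 : ℝ) - 1) = 1 := by norm_num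
  simp only [h1, Real.rpow_one, Real.Gamma_two, mul_one, Real.rpow_two, one_div, inv_pow] at h
  rw [one_div]
  refine ⟨by_contra fun hn => ?_, h⟩
  have h2 : (0 : ℝ) < (y ^ 2)⁻¹ := by positivity
  exact h2.ne' (h ▸ integral_undef hn)

open MeasureTheory in
theorem integral_exp_neg_mul_Ioi_zero {y : ℝ} (hy : 0 < y) :
    IntegrableOn (fun t => Real.exp (-(y * t))) (Set.Ioi 0) ∧
      ∫ t in Set.Ioi 0, Real.exp (-(y * t)) = 1 / y := by
  have h1 := integrableOn_exp_mul_Ioi (neg_lt_zero.2 hy) 0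
  have h2 := integral_exp_mul_Ioi (neg_lt_zero.2 hy) 0
  simp only [neg_mul, mul_zero, Real.exp_zero, neg_div_neg_eq] at h1 h2
  exact ⟨h1, h2⟩

open MeasureTheory in
theorem integral_herglotzDeriv_term {y : ℝ} (hy : 0 < y) :
    IntegrableOn (fun t => (t - 1 + Real.exp (-t)) * Real.exp (-(y * t))) (Set.Ioi 0) ∧
      ∫ t in Set.Ioi 0, (t - 1 + Real.exp (-t)) * Real.exp (-(y * t))
        = 1 / (y ^ 2 * (y + 1)) := by
  have hy1 : 0 < y + 1 := by linarith
  obtain ⟨i1, e1⟩ := integral_mul_exp_neg_mul_Ioi hy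
  obtain ⟨i2, e2⟩ := integral_exp_neg_mul_Ioi_zero hy
  obtain ⟨i3, e3⟩ := integral_exp_neg_mul_Ioi_zero hy1
  have hfun : (fun t => (t - 1 + Real.exp (-t)) * Real.exp (-(y * t)))
      = fun t => t * Real.exp (-(y * t)) - Real.exp (-(y * t)) + Real.exp (-((y + 1) * t)) := by
    ext t
    rw [show -((y + 1) * t) = -t + -(y * t) by ring, Real.exp_add]
    ring
  rw [hfun]
  refine ⟨(i1.sub i2).add i3, ?_⟩
  have i12 : IntegrableOn (fun t => t * Real.exp (-(y * t)) - Real.exp (-(y * t)))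
      (Set.Ioi 0) := i1.sub i2
  rw [integral_add i12 i3, integral_sub i1 i2, e1, e2, e3]
  field_simp
  ring

theorem tsum_exp_neg_pow_succ {z : ℝ} (hz : 0 < z) :
    (Summable fun n : ℕ => Real.exp (-(((n : ℝ) + 1) * z))) ∧
      ∑' n : ℕ, Real.exp (-(((n : ℝ) + 1) * z)) = 1 / (Real.exp z - 1) := by
  have hlt : Real.exp (-z) < 1 := Real.exp_lt_one_iff.2 (neg_lt_zero.2 hz)
  have hfun : (fun n : ℕ => Real.exp (-(((n : ℝ) + 1) * z)))
      = fun n : ℕ => Real.exp (-z) * Real.exp (-z) ^ n := by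
    ext n
    rw [← Real.exp_nat_mul, ← Real.exp_add]
    congr 1
    ring
  have h := (hasSum_geometric_of_lt_one (Real.exp_pos (-z)).le hlt).mul_left (Real.exp (-z))
  rw [hfun]
  refine ⟨h.summable, ?_⟩
  rw [h.tsum_eq]
  have h1 : 1 < Real.exp z := Real.one_lt_exp_iff.2 hz
  have h2 : Real.exp z - 1 ≠ 0 := by linarith
  rw [Real.exp_neg]
  field_simp

theorem tsum_exp_neg_pow {z : ℝ} (hz : 0 < z) :
    (Summable fun n : ℕ => Real.exp (-((n : ℝ) * z))) ∧
      ∑' n : ℕ, Real.exp (-((n : ℝ) * z)) = 1 / (1 - Real.exp (-z)) := by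
  have hlt : Real.exp (-z) < 1 := Real.exp_lt_one_iff.2 (neg_lt_zero.2 hz)
  have hfun : (fun n : ℕ => Real.exp (-((n : ℝ) * z))) = fun n : ℕ => Real.exp (-z) ^ n := by
    ext n
    rw [← Real.exp_nat_mul]
    congr 1
    ring
  have h := hasSum_geometric_of_lt_one (Real.exp_pos (-z)).le hlt
  rw [hfun, one_div]
  exact ⟨h.summable, h.tsum_eq⟩

/-- The kernel of the integral representation of the derivative of the Herglotz function. -/
noncomputable def herglotzKernel (x t : ℝ) : ℝ :=
  (t / (1 - Real.exp (-t)) - 1) / (Real.exp (x * t) - 1)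

open MeasureTheory in
theorem integral_herglotzKernel {x : ℝ} (hx : 0 < x) :
    IntegrableOn (herglotzKernel x) (Set.Ioi 0) ∧
      ∫ t in Set.Ioi 0, herglotzKernel x t = herglotzDeriv x := by
  have hpos : ∀ p : ℕ × ℕ, 0 < ((p.1 : ℝ) + 1) * x + p.2 := fun p => by positivity
  refine integrableOn_and_integral_eq_of_hasSum
    (f := fun (p : ℕ × ℕ) t =>
      (t - 1 + Real.exp (-t)) * Real.exp (-((((p.1 : ℝ) + 1) * x + p.2) * t)))
    (fun p t _ => ?_) (fun p => (integral_herglotzDeriv_term (hpos p)).1)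
    (fun p => (integral_herglotzDeriv_term (hpos p)).2) (summable_herglotzDeriv hx).hasSum ?_
    fun t ht => ?_
  · exact mul_nonneg (by linarith [Real.add_one_le_exp (-t)]) (Real.exp_pos _).le
  · refine ((summable_herglotzDeriv hx).tsum_pos (fun p => ?_) (0, 0) ?_).ne'
    · have := hpos p
      positivity
    · have := hpos (0, 0)
      positivity
  · rw [Set.mem_Ioi] at ht
    obtain ⟨s1, e1⟩ := tsum_exp_neg_pow_succ (mul_pos hx ht)
    obtain ⟨s2, e2⟩ := tsum_exp_neg_pow ht
    have hprod := tsum_mul_tsum_of_summable_norm s1.norm s2.norm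
    have hterm : ∀ p : ℕ × ℕ, Real.exp (-((((p.1 : ℝ) + 1) * x + p.2) * t))
        = Real.exp (-(((p.1 : ℝ) + 1) * (x * t))) * Real.exp (-((p.2 : ℝ) * t)) := fun p => by
      rw [← Real.exp_add]
      congr 1
      ring
    simp_rw [hterm]
    rw [tsum_mul_left, ← hprod, e1, e2, herglotzKernel]
    have h1 : 1 - Real.exp (-t) ≠ 0 := by
      have := Real.exp_lt_one_iff.2 (neg_lt_zero.2 ht)
      linarith
    have h2 : Real.exp (x * t) - 1 ≠ 0 := by
      have := Real.one_lt_exp_iff.2 (mul_pos hx ht)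
      linarith
    field_simp
    ring

open MeasureTheory in
/-- The Bose integral `∫₀^∞ t / (exp (x t) - 1) dt = π² / (6 x²)`. -/
theorem integral_div_exp_sub_one {x : ℝ} (hx : 0 < x) :
    IntegrableOn (fun t => t / (Real.exp (x * t) - 1)) (Set.Ioi 0) ∧
      ∫ t in Set.Ioi 0, t / (Real.exp (x * t) - 1) = Real.pi ^ 2 / 6 / x ^ 2 := by
  have hpos : ∀ n : ℕ, 0 < ((n : ℝ) + 1) * x := fun n => by positivity
  refine integrableOn_and_integral_eq_of_hasSum
    (f := fun (n : ℕ) t => t * Real.exp (-((((n : ℝ) + 1) * x) * t)))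
    (fun n t ht => mul_nonneg (le_of_lt ht) (Real.exp_pos _).le)
    (fun n => (integral_mul_exp_neg_mul_Ioi (hpos n)).1)
    (fun n => (integral_mul_exp_neg_mul_Ioi (hpos n)).2) ?_ (by positivity) fun t ht => ?_
  · have h := (hasSum_nat_add_iff' 1).2 hasSum_zeta_two
    convert! h.div_const (x ^ 2) using 1
    · ext n
      push_cast
      field_simp
    · simp
  · rw [Set.mem_Ioi] at ht
    simp_rw [mul_assoc]
    rw [tsum_mul_left, (tsum_exp_neg_pow_succ (mul_pos hx ht)).2]
    ring

open MeasureTheory in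
theorem integral_div_exp_add_one {x : ℝ} (hx : 0 < x) :
    IntegrableOn (fun t => t / (Real.exp (x * t) + 1)) (Set.Ioi 0) ∧
      ∫ t in Set.Ioi 0, t / (Real.exp (x * t) + 1) = Real.pi ^ 2 / 12 / x ^ 2 := by
  obtain ⟨i1, e1⟩ := integral_div_exp_sub_one hx
  obtain ⟨i2, e2⟩ := integral_div_exp_sub_one (mul_pos two_pos hx)
  have hfun : Set.EqOn (fun t => t / (Real.exp (x * t) - 1) - 2 * (t / (Real.exp (2 * x * t) - 1)))
      (fun t => t / (Real.exp (x * t) + 1)) (Set.Ioi 0) := by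
    intro t ht
    have h1 := Real.one_lt_exp_iff.2 (mul_pos hx ht)
    have h2 : Real.exp (2 * x * t) = Real.exp (x * t) ^ 2 := by
      rw [← Real.exp_nat_mul]
      push_cast
      ring_nf
    simp only [h2]
    generalize Real.exp (x * t) = Y at h1
    have h3 : Y - 1 ≠ 0 := by linarith
    have h4 : Y + 1 ≠ 0 := by linarith
    rw [show Y ^ 2 - 1 = (Y - 1) * (Y + 1) by ring]
    field_simp
    ring
  refine ⟨(integrableOn_congr_fun hfun measurableSet_Ioi).1 (i1.sub (i2.const_mul 2)), ?_⟩
  rw [← setIntegral_congr_fun measurableSet_Ioi hfun, integral_sub i1 (i2.const_mul 2),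
    integral_const_mul, e1, e2]
  field_simp
  ring

theorem hasDerivAt_log_one_sub_exp {a s : ℝ} (ha : 0 < a) (hs : 0 < s) :
    HasDerivAt (fun s => Real.log (1 - Real.exp (-(a * s)))) (a / (Real.exp (a * s) - 1)) s := by
  have h1 := Real.one_lt_exp_iff.2 (mul_pos ha hs)
  have h2 := Real.exp_lt_one_iff.2 (neg_lt_zero.2 (mul_pos ha hs))
  have h3 : HasDerivAt (fun s => -(a * s)) (-a) s := by
    simpa using ((hasDerivAt_id s).const_mul a).fun_neg
  have h4 : 1 - Real.exp (-(a * s)) ≠ 0 := by linarith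
  convert! (h3.exp.const_sub 1).log h4 using 1
  have h5 : Real.exp (a * s) - 1 ≠ 0 := by linarith
  rw [Real.exp_neg] at h4 ⊢
  field_simp

theorem tendsto_log_one_sub_exp_atTop {a : ℝ} (ha : 0 < a) :
    Filter.Tendsto (fun s => Real.log (1 - Real.exp (-(a * s)))) Filter.atTop (nhds 0) := by
  have h1 : Filter.Tendsto (fun s => Real.exp (-(a * s))) Filter.atTop (nhds 0) :=
    Real.tendsto_exp_neg_atTop_nhds_zero.comp (Filter.tendsto_id.const_mul_atTop ha)
  have h2 := (h1.const_sub 1).log (by norm_num)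
  simpa using h2

theorem tendsto_log_one_sub_exp_sub_log {a : ℝ} (ha : 0 < a) :
    Filter.Tendsto (fun s => Real.log (1 - Real.exp (-(a * s))) - Real.log s)
      (nhdsWithin 0 (Set.Ioi 0)) (nhds (Real.log a)) := by
  have h3 : HasDerivAt (fun s => -(a * s)) (-a) 0 := by
    simpa using ((hasDerivAt_id (0 : ℝ)).const_mul a).fun_neg
  have h4 := (h3.exp.const_sub 1).tendsto_slope_zero_right.log (by simpa using ha.ne')
  simp only [mul_zero, neg_zero, Real.exp_zero, one_mul, neg_neg, zero_add, sub_self, sub_zero,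
    smul_eq_mul] at h4
  refine h4.congr' ?_
  filter_upwards [self_mem_nhdsWithin] with s hs
  rw [Set.mem_Ioi] at hs
  have h2 := Real.exp_lt_one_iff.2 (neg_lt_zero.2 (mul_pos ha hs))
  rw [Real.log_mul (inv_pos.2 hs).ne' (by linarith), Real.log_inv]
  ring

open MeasureTheory in
theorem integral_elementary_part {u : ℝ} (hu : 0 < u)
    (hgi : IntegrableOn (fun s => -(1 / (Real.exp (u * s) - 1)) + 1 / (Real.exp ((u + 1) * s) - 1)
      + 2 / (u + 1) * (1 / (Real.exp (2 * u * s) - 1))) (Set.Ioi 0)) :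
    ∫ s in Set.Ioi 0, (-(1 / (Real.exp (u * s) - 1)) + 1 / (Real.exp ((u + 1) * s) - 1)
      + 2 / (u + 1) * (1 / (Real.exp (2 * u * s) - 1)))
      = Real.log u / u - Real.log (u + 1) / (u + 1) - Real.log (2 * u) / (u * (u + 1)) := by
  have hu1 : 0 < u + 1 := by linarith
  have hu2 : 0 < 2 * u := by linarith
  set L : ℝ := -(Real.log u / u) + Real.log (u + 1) / (u + 1)
    + Real.log (2 * u) / (u * (u + 1)) with hL
  set G : ℝ → ℝ := fun s => -(Real.log (1 - Real.exp (-(u * s))) / u)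
    + Real.log (1 - Real.exp (-((u + 1) * s))) / (u + 1)
    + Real.log (1 - Real.exp (-(2 * u * s))) / (u * (u + 1)) with hG
  have hne : ∀ s ∈ Set.Ioi (0 : ℝ), Function.update G 0 L =ᶠ[nhds s] G := fun s hs => by
    filter_upwards [lt_mem_nhds hs] with t ht
    exact Function.update_of_ne (ne_of_gt ht) _ _
  have hlim : Filter.Tendsto G (nhdsWithin 0 (Set.Ioi 0)) (nhds L) := by
    have h := (((tendsto_log_one_sub_exp_sub_log hu).div_const u).neg.add
      ((tendsto_log_one_sub_exp_sub_log hu1).div_const (u + 1))).add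
      ((tendsto_log_one_sub_exp_sub_log hu2).div_const (u * (u + 1)))
    refine h.congr fun s => ?_
    simp only [hG]
    field_simp
    ring
  have h := integral_Ioi_of_hasDerivAt_of_tendsto (f := Function.update G 0 L) (a := 0) (m := 0)
    ?_ (fun s hs => HasDerivAt.congr_of_eventuallyEq ?_ (hne s hs)) hgi ?_
  · rw [h, Function.update_self, hL]
    ring
  · rw [continuousWithinAt_update_same]
    simpa using hlim
  · have := (((hasDerivAt_log_one_sub_exp hu hs).div_const u).neg.add
      ((hasDerivAt_log_one_sub_exp hu1 hs).div_const (u + 1))).add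
      ((hasDerivAt_log_one_sub_exp hu2 hs).div_const (u * (u + 1)))
    convert! this using 1
    field_simp
  · have h0 := (((tendsto_log_one_sub_exp_atTop hu).div_const u).neg.add
      ((tendsto_log_one_sub_exp_atTop hu1).div_const (u + 1))).add
      ((tendsto_log_one_sub_exp_atTop hu2).div_const (u * (u + 1)))
    simp only [zero_div, neg_zero, add_zero] at h0
    refine h0.congr' ?_
    filter_upwards [Filter.eventually_gt_atTop 0] with t ht
    exact (Function.update_of_ne (ne_of_gt ht) L G).symm

open MeasureTheory in
theorem Jfun_eq_integral_Ioi (x : ℝ) :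
    Jfun x = ∫ s in Set.Ioi 0, Real.log (1 + Real.exp (-(x * s))) / (Real.exp s + 1) := by
  have himg : (fun s : ℝ => Real.exp (-s)) '' Set.Ioi 0 = Set.Ioo 0 1 := by
    ext t
    constructor
    · rintro ⟨s, hs, rfl⟩
      exact ⟨Real.exp_pos _, Real.exp_lt_one_iff.2 (neg_lt_zero.2 hs)⟩
    · rintro ⟨h0, h1⟩
      refine ⟨-Real.log t, ?_, ?_⟩
      · simpa using Real.log_neg h0 h1
      · simp [Real.exp_log h0]
  have h := integral_image_eq_integral_abs_deriv_smul (s := Set.Ioi (0 : ℝ))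
    (f := fun s => Real.exp (-s)) (f' := fun s => -Real.exp (-s)) measurableSet_Ioi
    (fun s _ => by simpa using ((hasDerivAt_id s).neg.exp).hasDerivWithinAt)
    (fun a _ b _ hab => by simpa using hab) (fun t => Real.log (1 + t ^ x) / (1 + t))
  rw [himg] at h
  rw [Jfun, intervalIntegral.integral_of_le zero_le_one, integral_Ioc_eq_integral_Ioo, h]
  refine setIntegral_congr_fun measurableSet_Ioi fun s _ => ?_
  have h1 : Real.exp (-s) ^ x = Real.exp (-(x * s)) := by
    rw [← Real.exp_mul]
    ring_nf
  simp only [abs_neg, abs_of_pos (Real.exp_pos _), smul_eq_mul, h1]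
  rw [Real.exp_neg s]
  have := Real.exp_pos s
  field_simp

/-- The kernel of the derivative of `J`. -/
noncomputable def jKernel (x s : ℝ) : ℝ := s / ((Real.exp (x * s) + 1) * (Real.exp s + 1))

theorem continuous_jKernel (x : ℝ) : Continuous (jKernel x) := by
  unfold jKernel
  refine Continuous.div (by fun_prop) (by fun_prop) fun s => ?_
  positivity

open MeasureTheory in
theorem hasDerivAt_Jfun {x : ℝ} (hx : 0 < x) :
    IntegrableOn (jKernel x) (Set.Ioi 0) ∧
      HasDerivAt Jfun (-∫ s in Set.Ioi 0, jKernel x s) x := by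
  have hcont : ∀ y : ℝ, Continuous fun s => Real.log (1 + Real.exp (-(y * s)))
      / (Real.exp s + 1) := fun y => by
    refine Continuous.div (Continuous.log (by fun_prop) fun s => ?_) (by fun_prop) fun s => ?_ <;>
    positivity
  obtain ⟨i1, -⟩ := integral_mul_exp_neg_mul_Ioi one_pos
  obtain ⟨i0, -⟩ := integral_exp_neg_mul_Ioi_zero one_pos
  have hle : ∀ s : ℝ, 1 / (Real.exp s + 1) ≤ Real.exp (-(1 * s)) := fun s => by
    rw [one_mul, Real.exp_neg, ← one_div]
    exact one_div_le_one_div_of_le (Real.exp_pos _) (by linarith)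
  have h := hasDerivAt_integral_of_dominated_loc_of_deriv_le (𝕜 := ℝ)
    (μ := volume.restrict (Set.Ioi (0 : ℝ))) (s := Set.Ioi 0) (x₀ := x)
    (F := fun y s => Real.log (1 + Real.exp (-(y * s))) / (Real.exp s + 1))
    (F' := fun y s => -jKernel y s) (bound := fun s => s * Real.exp (-(1 * s)))
    (Ioi_mem_nhds hx) (Filter.Eventually.of_forall fun y => (hcont y).aestronglyMeasurable) ?_
    (continuous_jKernel x).neg.aestronglyMeasurable ?_ i1 ?_
  · obtain ⟨h1, h2⟩ := h
    refine ⟨by simpa using! h1.neg, ?_⟩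
    rw [integral_neg] at h2
    exact h2.congr_of_eventuallyEq (Filter.Eventually.of_forall Jfun_eq_integral_Ioi)
  · refine (i0.const_mul (Real.log 2)).mono' (hcont x).aestronglyMeasurable ?_
    filter_upwards [ae_restrict_mem measurableSet_Ioi] with s hs
    rw [Set.mem_Ioi] at hs
    have h1 := Real.exp_lt_one_iff.2 (neg_lt_zero.2 (mul_pos hx hs))
    have h2 := Real.exp_pos (-(x * s))
    have h3 : 0 ≤ Real.log (1 + Real.exp (-(x * s))) := Real.log_nonneg (by linarith)
    rw [Real.norm_of_nonneg (by positivity), div_eq_mul_one_div]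
    refine mul_le_mul (Real.log_le_log (by linarith) (by linarith)) (hle s) (by positivity)
      (Real.log_nonneg one_le_two)
  · filter_upwards [ae_restrict_mem measurableSet_Ioi] with s hs y hy
    rw [Set.mem_Ioi] at hs
    rw [norm_neg, jKernel, Real.norm_of_nonneg (by positivity), div_eq_mul_one_div]
    refine mul_le_mul_of_nonneg_left (le_trans ?_ (hle s)) hs.le
    refine one_div_le_one_div_of_le (by positivity) ?_
    nlinarith [Real.exp_pos (y * s), Real.exp_pos s]
  · filter_upwards [ae_restrict_mem measurableSet_Ioi] with s hs y hy
    have h3 : HasDerivAt (fun y => -(y * s)) (-s) y := by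
      simpa using ((hasDerivAt_id y).mul_const s).fun_neg
    have h4 : 1 + Real.exp (-(y * s)) ≠ 0 := by positivity
    convert! ((h3.exp.const_add 1).log h4).div_const (Real.exp s + 1) using 1
    have := Real.exp_pos (y * s)
    rw [jKernel, Real.exp_neg]
    field_simp

/-- The pointwise identity of kernels behind the Hecke-type relation for the Herglotz function. -/
theorem herglotzKernel_relation {u s : ℝ} (hu : 0 < u) (hs : 0 < s) :
    herglotzKernel u s - herglotzKernel ((u + 1) / 2) (2 * s)
        - 2 / (u + 1) * herglotzKernel (2 * u / (u + 1)) ((u + 1) * s)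
        - s / (Real.exp (u * s) + 1) + jKernel u s
      = -(1 / (Real.exp (u * s) - 1)) + 1 / (Real.exp ((u + 1) * s) - 1)
      + 2 / (u + 1) * (1 / (Real.exp (2 * u * s) - 1)) := by
  have hX := Real.one_lt_exp_iff.2 hs
  have hY := Real.one_lt_exp_iff.2 (mul_pos hu hs)
  have e1 : Real.exp ((u + 1) * s) = Real.exp s * Real.exp (u * s) := by
    rw [← Real.exp_add]
    ring_nf
  have e2 : Real.exp (2 * u * s) = Real.exp (u * s) ^ 2 := by
    rw [← Real.exp_nat_mul]
    push_cast
    ring_nf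
  have e3 : Real.exp ((u + 1) / 2 * (2 * s)) = Real.exp s * Real.exp (u * s) := by
    rw [← e1]
    ring_nf
  have e4 : Real.exp (2 * u / (u + 1) * ((u + 1) * s)) = Real.exp (u * s) ^ 2 := by
    rw [← e2]
    congr 1
    field_simp
  have e5 : Real.exp (2 * s) = Real.exp s ^ 2 := by
    rw [← Real.exp_nat_mul]
    push_cast
    ring_nf
  simp only [herglotzKernel, jKernel, Real.exp_neg, e1, e2, e3, e4, e5]
  generalize Real.exp s = X at *
  generalize Real.exp (u * s) = Y at *
  have hXY : 1 < X * Y := one_lt_mul_of_lt_of_le hX hY.le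
  have hX0 : X ≠ 0 := by linarith
  have hY0 : Y ≠ 0 := by linarith
  have h1 : X - 1 ≠ 0 := by linarith
  have h2 : Y - 1 ≠ 0 := by linarith
  have h3 : X * Y - 1 ≠ 0 := by linarith
  have h4 : X + 1 ≠ 0 := by linarith
  have h5 : Y + 1 ≠ 0 := by linarith
  have h6 : u + 1 ≠ 0 := by linarith
  have i1 : s / (1 - X⁻¹) = s * X / (X - 1) := by
    rw [← one_div, one_sub_div hX0, div_div_eq_mul_div]
  have i2 : 2 * s / (1 - (X ^ 2)⁻¹) = 2 * s * X ^ 2 / ((X - 1) * (X + 1)) := by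
    rw [← one_div, one_sub_div (by positivity), div_div_eq_mul_div]
    ring_nf
  have i3 : (u + 1) * s / (1 - (X * Y)⁻¹) = (u + 1) * s * (X * Y) / (X * Y - 1) := by
    rw [← one_div, one_sub_div (by positivity), div_div_eq_mul_div]
  rw [i1, i2, i3, show Y ^ 2 - 1 = (Y - 1) * (Y + 1) by ring]
  field_simp
  ring

open MeasureTheory in
theorem integral_herglotzKernel_comp_mul {x b : ℝ} (hx : 0 < x) (hb : 0 < b) :
    IntegrableOn (fun s => herglotzKernel x (b * s)) (Set.Ioi 0) ∧
      ∫ s in Set.Ioi 0, herglotzKernel x (b * s) = herglotzDeriv x / b := by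
  obtain ⟨i, e⟩ := integral_herglotzKernel hx
  refine ⟨(integrableOn_Ioi_comp_mul_left_iff _ 0 hb).2 (by simpa using i), ?_⟩
  rw [integral_comp_mul_left_Ioi _ 0 hb, mul_zero, e, smul_eq_mul]
  ring

open MeasureTheory in
theorem herglotzDeriv_relation {u : ℝ} (hu : 0 < u) :
    herglotzDeriv u - herglotzDeriv ((u + 1) / 2) / 2
        - 2 / (u + 1) * (herglotzDeriv (2 * u / (u + 1)) / (u + 1))
        - Real.pi ^ 2 / 12 / u ^ 2 + ∫ s in Set.Ioi 0, jKernel u s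
      = Real.log u / u - Real.log (u + 1) / (u + 1) - Real.log (2 * u) / (u * (u + 1)) := by
  have hu1 : 0 < u + 1 := by linarith
  obtain ⟨i1, e1⟩ := integral_herglotzKernel hu
  obtain ⟨i2, e2⟩ := integral_herglotzKernel_comp_mul (x := (u + 1) / 2) (by positivity) two_pos
  obtain ⟨i3, e3⟩ := integral_herglotzKernel_comp_mul (x := 2 * u / (u + 1)) (by positivity) hu1
  obtain ⟨i4, e4⟩ := integral_div_exp_add_one hu
  have i5 := (hasDerivAt_Jfun hu).1
  have j2 : IntegrableOn (fun s => herglotzKernel u s - herglotzKernel ((u + 1) / 2) (2 * s))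
    (Set.Ioi 0) := i1.sub i2
  have j3 : IntegrableOn (fun s => herglotzKernel u s - herglotzKernel ((u + 1) / 2) (2 * s)
    - 2 / (u + 1) * herglotzKernel (2 * u / (u + 1)) ((u + 1) * s)) (Set.Ioi 0) :=
    j2.sub (i3.const_mul _)
  have j4 : IntegrableOn (fun s => herglotzKernel u s - herglotzKernel ((u + 1) / 2) (2 * s)
    - 2 / (u + 1) * herglotzKernel (2 * u / (u + 1)) ((u + 1) * s)
    - s / (Real.exp (u * s) + 1)) (Set.Ioi 0) := j3.sub i4
  have j5 : IntegrableOn (fun s => herglotzKernel u s - herglotzKernel ((u + 1) / 2) (2 * s)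
    - 2 / (u + 1) * herglotzKernel (2 * u / (u + 1)) ((u + 1) * s)
    - s / (Real.exp (u * s) + 1) + jKernel u s) (Set.Ioi 0) := j4.add i5
  have hfun : Set.EqOn (fun s => herglotzKernel u s - herglotzKernel ((u + 1) / 2) (2 * s)
      - 2 / (u + 1) * herglotzKernel (2 * u / (u + 1)) ((u + 1) * s)
      - s / (Real.exp (u * s) + 1) + jKernel u s)
      (fun s => -(1 / (Real.exp (u * s) - 1)) + 1 / (Real.exp ((u + 1) * s) - 1)
      + 2 / (u + 1) * (1 / (Real.exp (2 * u * s) - 1))) (Set.Ioi 0) :=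
    fun s hs => herglotzKernel_relation hu hs
  rw [← integral_elementary_part hu ((integrableOn_congr_fun hfun measurableSet_Ioi).1 j5),
    ← setIntegral_congr_fun measurableSet_Ioi hfun, integral_add j4 i5, integral_sub j3 i4,
    integral_sub j2 (i3.const_mul _), integral_sub i1 i2, integral_const_mul, e1, e2, e3, e4]

/-- The defect of the Hecke-type relation between `J` and the Herglotz function. -/
noncomputable def heckeDefect (u : ℝ) : ℝ :=
  Jfun u - herglotzF u + herglotzF ((u + 1) / 2) + herglotzF (2 * u / (u + 1))

theorem hasDerivAt_heckeDefect {u : ℝ} (hu : 0 < u) :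
    HasDerivAt heckeDefect (-(Real.log u / u - Real.log (u + 1) / (u + 1)
      - Real.log (2 * u) / (u * (u + 1))) - Real.pi ^ 2 / 12 / u ^ 2) u := by
  have hu1 : 0 < u + 1 := by linarith
  have d1 : HasDerivAt (fun u : ℝ => (u + 1) / 2) (1 / 2) u :=
    ((hasDerivAt_id u).add_const 1).div_const 2
  have d2 : HasDerivAt (fun u : ℝ => 2 * u / (u + 1)) (2 / (u + 1) ^ 2) u := by
    convert! ((hasDerivAt_id u).const_mul 2).div ((hasDerivAt_id u).add_const 1) hu1.ne' using 1
    simp only [id]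
    field_simp
    ring
  have h1 := (hasDerivAt_herglotzF (x := (u + 1) / 2) (by positivity)).comp u d1
  have h2 := (hasDerivAt_herglotzF (x := 2 * u / (u + 1)) (by positivity)).comp u d2
  convert! (((hasDerivAt_Jfun hu).2.sub (hasDerivAt_herglotzF hu)).add h1).add h2 using 1
  have h := herglotzDeriv_relation hu
  rw [← h]
  field_simp
  ring

/-- The reciprocity law `J(u) + J(1/u) = log² 2`. -/
theorem Jfun_add_Jfun_inv {u : ℝ} (hu : 0 < u) :
    Jfun u + Jfun (1 / u) = Real.log 2 ^ 2 := by
  have hJ1 : Jfun 1 = Real.log 2 ^ 2 / 2 := by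
    have h : ∀ t ∈ Set.uIcc (0 : ℝ) 1,
        HasDerivAt (fun t => Real.log (1 + t) ^ 2 / 2) (Real.log (1 + t ^ (1 : ℝ)) / (1 + t)) t := by
      intro t ht
      rw [Set.uIcc_of_le zero_le_one] at ht
      have h1 : 1 + t ≠ 0 := by linarith [ht.1]
      convert! ((((hasDerivAt_id t).const_add 1).log h1).pow 2).div_const 2 using 1
      simp
      ring
    have hc : ContinuousOn (fun t : ℝ => Real.log (1 + t ^ (1 : ℝ)) / (1 + t))
        (Set.uIcc 0 1) := by
      simp only [Real.rpow_one]
      rw [Set.uIcc_of_le zero_le_one]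
      have hne : ∀ t ∈ Set.Icc (0 : ℝ) 1, 1 + t ≠ 0 := fun t ht => by linarith [ht.1]
      exact ContinuousOn.div (ContinuousOn.log (by fun_prop) hne) (by fun_prop) hne
    rw [Jfun, intervalIntegral.integral_eq_sub_of_hasDerivAt h hc.intervalIntegrable]
    norm_num
  have hd : ∀ x ∈ Set.Ioi (0 : ℝ), HasDerivAt (fun x => Jfun x + Jfun (1 / x)) 0 x := by
    intro x hx
    rw [Set.mem_Ioi] at hx
    have hinv : HasDerivAt (fun x : ℝ => 1 / x) (-(1 / x ^ 2)) x := by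
      simpa [one_div] using hasDerivAt_inv hx.ne'
    have h1 := (hasDerivAt_Jfun (x := 1 / x) (by positivity)).2.comp x hinv
    convert! (hasDerivAt_Jfun hx).2.add h1 using 1
    have h2 := MeasureTheory.integral_comp_mul_left_Ioi (jKernel (1 / x)) 0 hx
    have h3 : ∀ s, jKernel (1 / x) (x * s) = x * jKernel x s := fun s => by
      rw [jKernel, jKernel, ← mul_assoc, one_div_mul_cancel hx.ne', one_mul]
      ring
    simp only [h3, mul_zero, MeasureTheory.integral_const_mul, smul_eq_mul] at h2
    field_simp at h2 ⊢
    linarith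
  have hconst := isOpen_Ioi.is_const_of_deriv_eq_zero (convex_Ioi (0 : ℝ)).isPreconnected
    (fun x hx => (hd x hx).differentiableAt.differentiableWithinAt)
    (fun x hx => (hd x hx).deriv) (Set.mem_Ioi.2 hu) (Set.mem_Ioi.2 one_pos)
  simp only [one_div_one, hJ1] at hconst
  linarith

theorem hasDerivAt_Li2 {x : ℝ} (h0 : 0 < x) (h1 : x < 1) :
    HasDerivAt Li2 (-Real.log (1 - x) / x) x := by
  obtain ⟨r, hxr, hr1⟩ := exists_between h1
  have hr0 : 0 < r := h0.trans hxr
  have habs : ∀ n : ℕ, x ^ (n + 1) / ((n : ℝ) + 1) ^ 2 ≤ x * x ^ n := fun n => by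
    rw [← pow_succ']
    exact div_le_self (by positivity) (by nlinarith [n.cast_nonneg (α := ℝ)])
  have h := hasDerivAt_tsum_of_isPreconnected (𝕜 := ℝ)
    (g := fun (n : ℕ) y => y ^ (n + 1) / ((n : ℝ) + 1) ^ 2)
    (g' := fun (n : ℕ) y => y ^ n / ((n : ℝ) + 1)) (u := fun n => r ^ n)
    (summable_geometric_of_lt_one hr0.le hr1) isOpen_Ioo (convex_Ioo 0 r).isPreconnected
    (fun n y _ => ?_) (fun n y hy => ?_) ⟨h0, hxr⟩
    (((summable_geometric_of_lt_one h0.le h1).mul_left x).of_nonneg_of_le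
      (fun n => by positivity) habs) ⟨h0, hxr⟩
  · convert! h using 1
    have hs := (Real.hasSum_pow_div_log_of_abs_lt_one (abs_lt.2 ⟨by linarith, h1⟩)).div_const x
    rw [← hs.tsum_eq]
    congr 1
    ext n
    field_simp
    ring
  · convert! ((hasDerivAt_pow (n + 1) y).div_const (((n : ℝ) + 1) ^ 2)) using 1
    push_cast
    field_simp
  · have hy0 := hy.1
    rw [Real.norm_of_nonneg (by positivity)]
    refine (div_le_self (by positivity) (by linarith [n.cast_nonneg (α := ℝ)])).trans ?_
    exact pow_le_pow_left₀ hy0.le hy.2.le n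

theorem continuousOn_Li2 : ContinuousOn Li2 (Set.Icc 0 1) := by
  refine continuousOn_tsum (u := fun n : ℕ => 1 / ((n : ℝ) + 1) ^ 2) (fun n => by fun_prop) ?_
    fun n x hx => ?_
  · have := (summable_nat_add_iff 1).2 (Real.summable_one_div_nat_pow.2 one_lt_two)
    exact_mod_cast this
  · have hx0 := hx.1
    rw [Real.norm_of_nonneg (by positivity)]
    gcongr
    exact pow_le_one₀ hx.1 hx.2

theorem Li2_one : Li2 1 = Real.pi ^ 2 / 6 := by
  have h := (hasSum_nat_add_iff' 1).2 hasSum_zeta_two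
  simp only [Finset.range_one, Finset.sum_singleton, Nat.cast_zero, ne_eq, OfNat.ofNat_ne_zero,
    not_false_eq_true, zero_pow, div_zero, sub_zero] at h
  rw [Li2, ← h.tsum_eq]
  simp

theorem rogersL_of_mem_Ioc {x : ℝ} (h0 : 0 < x) (h1 : x ≤ 1) :
    rogersL x = Li2 x + Real.log x * Real.log (1 - x) / 2 := by
  rw [rogersL, if_neg (not_lt.2 h0.le), if_pos h1]

/-- The antisymmetrization of the Hecke-type relation. -/
theorem heckeDefect_sub_heckeDefect_inv {u : ℝ} (hu : 1 < u) :
    heckeDefect u - heckeDefect (1 / u) + Real.pi ^ 2 / 12 * (u - 1 / u)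
      = Li2 ((1 / u) ^ 2) - 2 * Li2 (1 / u) - Real.log u * (Real.log (u + 1) - Real.log u)
        + Real.pi ^ 2 / 6 + Real.log 2 * Real.log u := by
  set T : ℝ → ℝ := fun x => heckeDefect x - heckeDefect (1 / x)
    + Real.pi ^ 2 / 12 * (x - 1 / x) - Li2 ((1 / x) ^ 2) + 2 * Li2 (1 / x)
    + Real.log x * (Real.log (x + 1) - Real.log x) - Real.log 2 * Real.log x with hT
  have hinv : ∀ x : ℝ, 0 < x → HasDerivAt (fun x : ℝ => 1 / x) (-(1 / x ^ 2)) x := fun x hx => by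
    simpa [one_div] using hasDerivAt_inv hx.ne'
  have hdefect : ∀ x : ℝ, 0 < x → HasDerivAt (fun x => heckeDefect x - heckeDefect (1 / x)
      + Real.pi ^ 2 / 12 * (x - 1 / x)) (Real.log (x + 1) / x + Real.log 2 / x
      - Real.log x / (x + 1)) x := by
    intro x hx
    have hx1 : 0 < x + 1 := by linarith
    have h1 := (hasDerivAt_heckeDefect (u := 1 / x) (by positivity)).comp x (hinv x hx)
    convert! ((hasDerivAt_heckeDefect hx).sub h1).add
      (((hasDerivAt_id x).sub (hinv x hx)).const_mul (Real.pi ^ 2 / 12)) using 1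
    have l1 : Real.log (1 / x + 1) = Real.log (x + 1) - Real.log x := by
      rw [← Real.log_div hx1.ne' hx.ne']
      congr 1
      field_simp
      ring
    rw [l1, Real.log_mul two_ne_zero hx.ne', Real.log_mul two_ne_zero (by positivity),
      one_div x, Real.log_inv]
    field_simp
    ring
  have hlog : ∀ x : ℝ, 0 < x → HasDerivAt
      (fun x => Real.log x * (Real.log (x + 1) - Real.log x))
      ((Real.log (x + 1) - Real.log x) / x + Real.log x * (1 / (x + 1) - 1 / x)) x := by
    intro x hx
    have hl := Real.hasDerivAt_log hx.ne'
    have hl1 := ((hasDerivAt_id x).add_const 1).log (show x + 1 ≠ 0 by linarith)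
    convert! hl.mul (hl1.sub hl) using 1
    simp only [id, one_div, Pi.sub_apply]
    ring
  have hderiv : ∀ x ∈ Set.Ioo 1 u, HasDerivAt T 0 x := by
    intro x hx
    have hx0 : 0 < x := by linarith [hx.1]
    have hx1 : 0 < x - 1 := by linarith [hx.1]
    have hlt : 1 / x < 1 := (div_lt_one hx0).2 hx.1
    have hpos : 0 < 1 / x := by positivity
    have hsq : HasDerivAt (fun x : ℝ => (1 / x) ^ 2) (2 * (1 / x) * -(1 / x ^ 2)) x := by
      simpa using (hinv x hx0).fun_pow 2
    have h1 := (hasDerivAt_Li2 (x := (1 / x) ^ 2) (by positivity)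
      (pow_lt_one₀ hpos.le hlt two_ne_zero)).comp x hsq
    have h2 := (hasDerivAt_Li2 hpos hlt).comp x (hinv x hx0)
    convert! ((((hdefect x hx0).sub h1).add (h2.const_mul 2)).add (hlog x hx0)).sub
      ((Real.hasDerivAt_log hx0.ne').const_mul (Real.log 2)) using 1
    have l1 : Real.log (1 - 1 / x) = Real.log (x - 1) - Real.log x := by
      rw [← Real.log_div hx1.ne' hx0.ne']
      congr 1
      field_simp
    have l2 : Real.log (1 - (1 / x) ^ 2)
        = Real.log (x - 1) + Real.log (x + 1) - 2 * Real.log x := by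
      rw [show 2 * Real.log x = Real.log (x ^ 2) by simp [Real.log_pow],
        ← Real.log_mul hx1.ne' (by positivity), ← Real.log_div (by positivity) (by positivity)]
      congr 1
      field_simp
      ring
    rw [l1, l2]
    have : x + 1 ≠ 0 := by linarith
    field_simp
    ring
  have hcont : ContinuousOn T (Set.Icc 1 u) := by
    have hpos : ∀ x ∈ Set.Icc 1 u, 0 < x := fun x hx => by linarith [hx.1]
    have c0 : ContinuousOn (fun x : ℝ => 1 / x) (Set.Icc 1 u) := fun x hx =>
      (hinv x (hpos x hx)).continuousAt.continuousWithinAt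
    have hmem : ∀ x ∈ Set.Icc 1 u, 1 / x ∈ Set.Icc (0 : ℝ) 1 := fun x hx =>
      ⟨(one_div_pos.2 (hpos x hx)).le, (div_le_one (hpos x hx)).2 hx.1⟩
    have c1 : ContinuousOn (fun x => Li2 (1 / x)) (Set.Icc 1 u) := continuousOn_Li2.comp c0 hmem
    have c2 : ContinuousOn (fun x => Li2 ((1 / x) ^ 2)) (Set.Icc 1 u) :=
      continuousOn_Li2.comp (c0.pow 2) fun x hx =>
        ⟨by positivity, pow_le_one₀ (hmem x hx).1 (hmem x hx).2⟩
    have c3 := fun x hx => (hdefect x (hpos x hx)).continuousAt.continuousWithinAt (s := Set.Icc 1 u)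
    have c4 := fun x hx => (hlog x (hpos x hx)).continuousAt.continuousWithinAt (s := Set.Icc 1 u)
    have c5 : ContinuousOn Real.log (Set.Icc 1 u) :=
      Real.continuousOn_log.mono fun x hx => (hpos x hx).ne'
    exact ((((ContinuousOn.sub c3 c2).add (c1.const_mul 2)).add c4).sub
      (c5.const_mul (Real.log 2)))
  obtain ⟨c, _, hc⟩ := exists_hasDerivAt_eq_slope T (fun _ => 0) hu hcont hderiv
  have hu1 : u - 1 ≠ 0 := by linarith
  have hTu : T u = T 1 := by
    have := (div_eq_zero_iff.1 hc.symm).resolve_right hu1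
    linarith
  have hT1 : T 1 = Real.pi ^ 2 / 6 := by
    simp only [hT, one_div_one, one_pow, Li2_one, Real.log_one]
    ring
  rw [hT1] at hTu
  simp only [hT] at hTu
  linarith

theorem two_mathcalJ_eq (u : ℝ) (hu : 1 < u) :
    2 * mathcalJ u =
      mathcalP u (1 / u) - mathcalP ((u + 1) / 2) ((u + 1) / (2 * u))
        - mathcalP (2 * u / (u + 1)) (2 / (u + 1))
        + Real.pi ^ 2 / 6 + Real.log 2 * Real.log u := by
  have hu0 : 0 < u := by linarith
  have hu1 : 0 < u + 1 := by linarith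
  have hm1 : 0 < u - 1 := by linarith
  have hle : 1 / u ≤ 1 := (div_le_one hu0).2 hu.le
  have a1 : 1 / u / u = (1 / u) ^ 2 := by
    field_simp
  have a2 : (u + 1) / (2 * u) / ((u + 1) / 2) = 1 / u := by
    field_simp
  have a3 : 2 / (u + 1) / (2 * u / (u + 1)) = 1 / u := by
    field_simp
  have b1 : (1 / u + 1) / 2 = (u + 1) / (2 * u) := by
    field_simp
    ring
  have b2 : 2 * (1 / u) / (1 / u + 1) = 2 / (u + 1) := by
    field_simp
    ring
  have l0 : Real.log (1 / u) = -Real.log u := by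
    rw [one_div, Real.log_inv]
  have l1 : Real.log (1 - 1 / u) = Real.log (u - 1) - Real.log u := by
    rw [← Real.log_div hm1.ne' hu0.ne']
    congr 1
    field_simp
  have l2 : Real.log (1 - (1 / u) ^ 2)
      = Real.log (u - 1) + Real.log (u + 1) - 2 * Real.log u := by
    rw [show 2 * Real.log u = Real.log (u ^ 2) by simp [Real.log_pow],
      ← Real.log_mul hm1.ne' hu1.ne', ← Real.log_div (by positivity) (by positivity)]
    congr 1
    field_simp
    ring
  have l3 : Real.log ((1 / u) ^ 2) = -(2 * Real.log u) := by
    rw [Real.log_pow, l0]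
    push_cast
    ring
  have l4 : Real.log ((u + 1) / 2) = Real.log (u + 1) - Real.log 2 :=
    Real.log_div hu1.ne' two_ne_zero
  have l5 : Real.log ((u + 1) / (2 * u)) = Real.log (u + 1) - (Real.log 2 + Real.log u) := by
    rw [Real.log_div hu1.ne' (by positivity), Real.log_mul two_ne_zero hu0.ne']
  have l6 : Real.log (2 * u / (u + 1)) = Real.log 2 + Real.log u - Real.log (u + 1) := by
    rw [Real.log_div (by positivity) hu1.ne', Real.log_mul two_ne_zero hu0.ne']
  have l7 : Real.log (2 / (u + 1)) = Real.log 2 - Real.log (u + 1) :=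
    Real.log_div two_ne_zero hu1.ne'
  have hmain := heckeDefect_sub_heckeDefect_inv hu
  have hrec := Jfun_add_Jfun_inv hu0
  simp only [heckeDefect, b1, b2] at hmain
  simp only [mathcalJ, mathcalP, mathcalF, a1, a2, a3,
    rogersL_of_mem_Ioc (one_div_pos.2 hu0) hle,
    rogersL_of_mem_Ioc (pow_pos (one_div_pos.2 hu0) 2) (pow_le_one₀ (one_div_pos.2 hu0).le hle),
    l0, l1, l2, l3, l4, l5, l6, l7]
  have hrat : u - 2 + 1 / u - (1 / u - 2 + 1 / (1 / u))
      - ((u + 1) / 2 - 2 + 1 / ((u + 1) / 2)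
        - ((u + 1) / (2 * u) - 2 + 1 / ((u + 1) / (2 * u))))
      - (2 * u / (u + 1) - 2 + 1 / (2 * u / (u + 1))
        - (2 / (u + 1) - 2 + 1 / (2 / (u + 1)))) = 0 := by
    field_simp
    ring
  linear_combination hmain + hrec - Real.pi ^ 2 / 12 * hrat
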